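/- Let n = p₁^{r₁} p₂^{r₂} ⋯ p_k^{r_k} where the p_i are distinct primes and r_i ≥ 1 for every i. Then there exists a finite poset with automorphism group isomorphic to ℤ/nℤ having (Σ_{i=1}^k b(p_i^{r_i})·p_i^{r_i}) − 1 points if 3 ∥ n and 4 ∥ n, and having Σ_{i=1}^k b(p_i^{r_i})·p_i^{r_i} points otherwise. -/

import Mathlib

/-- `b` on prime powers: `b 1 = 0`, `b 2 = 1`, `b 3 = b 4 = b 5 = b 7 = 3`,
and `b (p^r) = 2` for every other prime power. -/
def b (q : ℕ) : ℕ :=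
  if q = 1 then 0
  else if q = 2 then 1
  else if q = 3 ∨ q = 4 ∨ q = 5 ∨ q = 7 then 3
  else 2

/-- A prime power `q = p^r` exactly divides `n` if `q ∣ n` and `p^(r+1) = q * p ∤ n`. -/
def ExactDvd (q n : ℕ) : Prop := q ∣ n ∧ ¬ (q * q.minFac ∣ n)

instance (q n : ℕ) : Decidable (ExactDvd q n) :=
  inferInstanceAs (Decidable (q ∣ n ∧ ¬ (q * q.minFac ∣ n)))

open Equiv

/-- There is a poset with `N` points whose automorphism group is cyclic of order `q`. -/
def RealizesCyclic (N q : ℕ) : Prop :=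
  ∃ (P : Type) (_ : PartialOrder P) (_ : Fintype P),
    Fintype.card P = N ∧ Nonempty ((P ≃o P) ≃* Multiplicative (ZMod q))

theorem realizesCyclic_zero_one : RealizesCyclic 0 1 := by
  refine ⟨PEmpty, inferInstance, inferInstance, by simp, ⟨?_⟩⟩
  have : Subsingleton (Multiplicative (ZMod 1)) := inferInstanceAs (Subsingleton (Fin 1))
  have : Subsingleton (PEmpty ≃o PEmpty) := ⟨fun _ _ => RelIso.ext fun x => x.elim⟩
  have := Unique.mk' (PEmpty ≃o PEmpty)
  have := Unique.mk' (Multiplicative (ZMod 1))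
  exact MulEquiv.ofUnique

/-- An automorphism of an ordinal sum of finite posets preserves the lower summand. -/
theorem mapsTo_range_inl_of_orderIso {P Q : Type} [PartialOrder P] [PartialOrder Q] [Finite P]
    [Finite Q] (σ : P ⊕ₗ Q ≃o P ⊕ₗ Q) :
    Set.MapsTo (fun x : P ⊕ Q => ofLex (σ (toLex x))) (Set.range Sum.inl) (Set.range Sum.inl) := by
  set τ : Perm (P ⊕ Q) := (toLex.trans σ.toEquiv).trans ofLex with hτ
  rintro _ ⟨p, rfl⟩
  change τ (Sum.inl p) ∈ _
  by_contra hcon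
  obtain ⟨y, hy⟩ : ∃ y, τ (Sum.inl p) = Sum.inr y := by
    rcases h : τ (Sum.inl p) with x | y
    · exact absurd ⟨x, h.symm⟩ hcon
    · exact ⟨y, rfl⟩
  have hsub : ∀ p', ∃ x, τ (Sum.inl x) = Sum.inl p' := by
    intro p'
    have h1 : toLex (Sum.inl p' : P ⊕ Q) ≤ σ (toLex (Sum.inl p)) := by
      have : σ (toLex (Sum.inl p)) = toLex (Sum.inr y) := by
        rw [← hy]; rfl
      rw [this]
      exact (Sum.Lex.inl_lt_inr p' y).le
    have h2 : σ.symm (toLex (Sum.inl p')) ≤ toLex (Sum.inl p) := by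
      rwa [← σ.le_iff_le, σ.apply_symm_apply]
    rcases h : ofLex (σ.symm (toLex (Sum.inl p'))) with x | z
    · refine ⟨x, ?_⟩
      rw [← h]
      simp [hτ]
    · have h3 : σ.symm (toLex (Sum.inl p')) = toLex (Sum.inr z) := by rw [← h]; rfl
      rw [h3] at h2
      exact absurd h2 (Sum.Lex.not_inr_le_inl)
  choose e he using hsub
  have e_inj : Function.Injective e := fun a b hab => by
    have := he a
    rw [hab, he b] at this
    exact (Sum.inl_injective this).symm
  obtain ⟨p', rfl⟩ := (Finite.injective_iff_surjective.mp e_inj) p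
  rw [he] at hy
  cases hy

/-- The automorphism group of an ordinal sum of finite posets is the product of the automorphism
groups of the summands. -/
theorem nonempty_mulEquiv_sumLex (P Q : Type) [PartialOrder P] [PartialOrder Q] [Finite P]
    [Finite Q] : Nonempty ((P ≃o P) × (Q ≃o Q) ≃* (P ⊕ₗ Q ≃o P ⊕ₗ Q)) := by
  let φ : (P ≃o P) × (Q ≃o Q) →* (P ⊕ₗ Q ≃o P ⊕ₗ Q) :=
    { toFun := fun a => OrderIso.sumLexCongr a.1 a.2
      map_one' := by
        ext x
        rcases x with x | x <;> rfl
      map_mul' := fun a b => by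
        ext x
        rcases x with x | x <;> rfl }
  refine ⟨MulEquiv.ofBijective φ ⟨fun a b hab => ?_, fun σ => ?_⟩⟩
  · have h : ∀ x, φ a x = φ b x := fun x => by rw [hab]
    ext x
    · exact Sum.inl_injective (h (Sum.inlₗ x))
    · exact Sum.inr_injective (h (Sum.inrₗ x))
  · let τ : Perm (P ⊕ Q) := (toLex.trans σ.toEquiv).trans ofLex
    obtain ⟨⟨α, β⟩, hαβ⟩ := Perm.mem_sumCongrHom_range_of_perm_mapsTo_inl (σ := τ)
      (mapsTo_range_inl_of_orderIso σ)
    have hα : ∀ p, σ (Sum.inlₗ p) = Sum.inlₗ (α p) := fun p =>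
      (congrArg (fun τ' : Perm (P ⊕ Q) => toLex (τ' (Sum.inl p))) hαβ).symm
    have hβ : ∀ p, σ (Sum.inrₗ p) = Sum.inrₗ (β p) := fun p =>
      (congrArg (fun τ' : Perm (P ⊕ Q) => toLex (τ' (Sum.inr p))) hαβ).symm
    refine ⟨⟨⟨α, fun {x y} => ?_⟩, ⟨β, fun {x y} => ?_⟩⟩, ?_⟩
    · refine (Sum.Lex.inl_le_inl_iff (β := Q)).symm.trans
        (Iff.trans ?_ (Sum.Lex.inl_le_inl_iff (β := Q)))
      exact (by rw [← hα, ← hα, σ.le_iff_le] :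
        (Sum.inlₗ (α x) : P ⊕ₗ Q) ≤ Sum.inlₗ (α y) ↔ (Sum.inlₗ x : P ⊕ₗ Q) ≤ Sum.inlₗ y)
    · refine (Sum.Lex.inr_le_inr_iff (α := P)).symm.trans
        (Iff.trans ?_ (Sum.Lex.inr_le_inr_iff (α := P)))
      exact (by rw [← hβ, ← hβ, σ.le_iff_le] :
        (Sum.inrₗ (β x) : P ⊕ₗ Q) ≤ Sum.inrₗ (β y) ↔ (Sum.inrₗ x : P ⊕ₗ Q) ≤ Sum.inrₗ y)
    · ext x
      rcases x with x | x
      · exact (hα x).symm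
      · exact (hβ x).symm

theorem RealizesCyclic.add {M N m n : ℕ} (hM : RealizesCyclic M m) (hN : RealizesCyclic N n)
    (h : m.Coprime n) : RealizesCyclic (M + N) (m * n) := by
  obtain ⟨P, _, _, hP, ⟨e⟩⟩ := hM
  obtain ⟨Q, _, _, hQ, ⟨f⟩⟩ := hN
  obtain ⟨φ⟩ := nonempty_mulEquiv_sumLex P Q
  refine ⟨P ⊕ₗ Q, inferInstance, inferInstanceAs (Fintype (P ⊕ Q)), ?_, ⟨?_⟩⟩
  · rw [← hP, ← hQ]
    exact Fintype.card_sum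
  · exact (φ.symm.trans (e.prodCongr f)).trans
      ((MulEquiv.prodMultiplicative (ZMod m) (ZMod n)).symm.trans
        (AddEquiv.toMultiplicative (ZMod.chineseRemainder h).toAddEquiv.symm))

theorem RealizesCyclic.sum {ι : Type*} [DecidableEq ι] (s : Finset ι) (N q : ι → ℕ)
    (h : ∀ i ∈ s, RealizesCyclic (N i) (q i))
    (hq : (s : Set ι).Pairwise fun i j => (q i).Coprime (q j)) :
    RealizesCyclic (∑ i ∈ s, N i) (∏ i ∈ s, q i) := by
  induction s using Finset.induction_on with
  | empty => simpa using realizesCyclic_zero_one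
  | insert a s ha ih =>
    rw [Finset.sum_insert ha, Finset.prod_insert ha]
    refine (h a (by simp)).add (ih (fun i hi => h i (by simp [hi]))
      (hq.mono (by simp))) (Nat.Coprime.prod_right fun i hi => ?_)
    exact hq (by simp) (by simp [hi]) (by rintro rfl; exact ha hi)

/-- A strict order all of whose automorphisms are powers of a single one, of order `q`. -/
theorem RealizesCyclic.of_isStrictOrder {α : Type} [Fintype α] (q : ℕ) (lt : α → α → Prop)
    [IsStrictOrder α lt] (τ : Perm α) (hτ : ∀ x y, lt (τ x) (τ y) ↔ lt x y)
    (hq : ∀ c : ℕ, τ ^ c = 1 ↔ q ∣ c)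
    (h : ∀ σ : Perm α, (∀ x y, lt (σ x) (σ y) ↔ lt x y) → ∃ c : ℕ, σ = τ ^ c) :
    RealizesCyclic (Fintype.card α) q := by
  let _ := partialOrderOfSO lt
  refine ⟨α, inferInstance, inferInstance, rfl, ?_⟩
  have hle : ∀ x y : α, x ≤ y ↔ x = y ∨ lt x y := fun _ _ => Iff.rfl
  let g : α ≃o α := ⟨τ, fun {x y} => by simp [hle, hτ]⟩
  have hg : ∀ (c : ℕ) (x : α), (g ^ c) x = (τ ^ c) x := by
    intro c
    induction c with
    | zero => intro x; rfl
    | succ c ih => intro x; rw [pow_succ, pow_succ]; exact ih (τ x)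
  have hord : orderOf g = q := by
    refine Nat.dvd_antisymm ?_ ?_
    · rw [orderOf_dvd_iff_pow_eq_one]
      ext x
      rw [hg, (hq q).2 dvd_rfl]
      rfl
    · rw [← hq]
      ext x
      rw [← hg, pow_orderOf_eq_one]
      rfl
  have hgen : ∀ σ : α ≃o α, σ ∈ Subgroup.zpowers g := by
    intro σ
    obtain ⟨c, hc⟩ := h σ.toEquiv fun x y => (OrderIso.lt_iff_lt σ : σ x < σ y ↔ x < y)
    refine ⟨c, ?_⟩
    ext x
    simp only [zpow_natCast]
    rw [hg, ← hc]
    rfl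
  have hcard : Nat.card (α ≃o α) = q := by
    rw [← orderOf_eq_card_of_forall_mem_zpowers hgen, hord]
  exact ⟨(zmodMulEquivOfGenerator hgen hcard).symm⟩

/-! ### Posets on few points -/

/-- The list `[f (k - 1), …, f 0]`. -/
def revValues (f : ℕ → ℕ) : ℕ → List ℕ
  | 0 => []
  | k + 1 => f k :: revValues f k

theorem eq_of_revValues_eq {f g : ℕ → ℕ} {k : ℕ} (h : revValues f k = revValues g k) :
    ∀ u < k, f u = g u := by
  induction k with
  | zero => intro u hu; omega
  | succ k ih =>
    simp only [revValues, List.cons.injEq] at h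
    intro u hu
    rcases Nat.lt_succ_iff_lt_or_eq.mp hu with hu | rfl
    · exact ih h.2 u hu
    · exact h.1

/-- Whether a partial automorphism `[f (j - 1), …, f 0]` of `R` is compatible with `k ↦ w`. -/
def extendsIso (R : ℕ → ℕ → Bool) (k w : ℕ) : List ℕ → ℕ → Bool
  | x :: l, j + 1 => !Nat.beq w x && (!xor (R w x) (R k j) && (!xor (R x w) (R j k) &&
      extendsIso R k w l j))
  | _, _ => true

/-- Whether every extension by `m` values of a partial automorphism `l = [f (k - 1), …, f 0]` of
the relation `R` on `{0, …, N - 1}` satisfies `ok`. -/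
def searchAut (N : ℕ) (R : ℕ → ℕ → Bool) (ok : List ℕ → Bool) : ℕ → ℕ → List ℕ → Bool
  | 0, _, l => ok l
  | m + 1, k, l => (List.range N).all fun w =>
      !extendsIso R k w l k || searchAut N R ok m (k + 1) (w :: l)

theorem extendsIso_revValues {N : ℕ} {R : ℕ → ℕ → Bool} {f : ℕ → ℕ}
    (hR : ∀ u < N, ∀ v < N, R (f u) (f v) = R u v) (hf : Set.InjOn f (Set.Iio N)) {k j : ℕ}
    (hk : k < N) (hj : j ≤ k) : extendsIso R k (f k) (revValues f j) j = true := by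
  induction j with
  | zero => rfl
  | succ j ih =>
    have hjk : f k ≠ f j := fun h => by
      have := hf (show k ∈ Set.Iio N from hk) (show j ∈ Set.Iio N from by simp; omega) h
      omega
    have hb : (f k).beq (f j) = false := Bool.eq_false_iff.mpr (mt Nat.eq_of_beq_eq_true hjk)
    simp [revValues, extendsIso, ih (by omega), hb, hR k hk j (by omega), hR j (by omega) k hk]

theorem ok_of_searchAut {N : ℕ} {R : ℕ → ℕ → Bool} {ok : List ℕ → Bool} {f : ℕ → ℕ}
    (hR : ∀ u < N, ∀ v < N, R (f u) (f v) = R u v) (hf : Set.InjOn f (Set.Iio N))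
    (hfN : ∀ u < N, f u < N) {m k : ℕ} (hmk : k + m = N)
    (h : searchAut N R ok m k (revValues f k) = true) : ok (revValues f N) = true := by
  induction m generalizing k with
  | zero =>
    obtain rfl : k = N := by omega
    exact h
  | succ m ih =>
    rw [searchAut, List.all_eq_true] at h
    have := h (f k) (List.mem_range.mpr (hfN k (by omega)))
    rw [extendsIso_revValues hR hf (by omega) le_rfl] at this
    exact ih (k := k + 1) (by omega) (by simpa [revValues] using this)

theorem RealizesCyclic.of_searchAut {N q : ℕ} (hq0 : 0 < q) (R : ℕ → ℕ → Bool) (t : ℕ → ℕ)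
    (hirr : ∀ u < N, R u u = false)
    (htrans : ∀ u < N, ∀ v < N, R u v = true → ∀ w < N, R v w = true → R u w = true)
    (htN : ∀ u < N, t u < N) (ht : ∀ u < N, t^[q] u = u)
    (htR : ∀ u < N, ∀ v < N, R (t u) (t v) = R u v)
    (htq : ∀ c < q, (∀ u < N, t^[c] u = u) → c = 0)
    (hs : searchAut N R (fun l => (List.range q).any fun c => l == revValues t^[c] N) N 0 [] =
      true) :
    RealizesCyclic N q := by
  have hiter : ∀ (c u : ℕ), u < N → t^[c] u < N := by
    intro c
    induction c with
    | zero => intro u hu; exact hu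
    | succ c ih => intro u hu; exact ih _ (htN u hu)
  let lt : Fin N → Fin N → Prop := fun u v => R u v = true
  have : IsStrictOrder (Fin N) lt :=
    { irrefl := fun u h => by simp [lt, hirr u u.2] at h
      trans := fun u v w h1 h2 => htrans u u.2 v v.2 h1 w w.2 h2 }
  let τ : Perm (Fin N) :=
    { toFun := fun u => ⟨t u, htN u u.2⟩
      invFun := fun u => ⟨t^[q - 1] u, hiter _ _ u.2⟩
      left_inv := fun u => Fin.ext (by
        change t^[q - 1] (t u) = u
        rw [← Function.iterate_succ_apply, Nat.succ_eq_add_one, Nat.sub_add_cancel hq0, ht u u.2])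
      right_inv := fun u => Fin.ext (by
        change t (t^[q - 1] u) = u
        rw [← Function.iterate_succ_apply' t, Nat.succ_eq_add_one, Nat.sub_add_cancel hq0,
          ht u u.2]) }
  have hτ : ∀ (c : ℕ) (u : Fin N), ((τ ^ c) u : ℕ) = t^[c] u := by
    intro c
    induction c with
    | zero => intro u; rfl
    | succ c ih => intro u; rw [pow_succ]; exact ih (τ u)
  have hτq : τ ^ q = 1 := by
    ext u
    rw [hτ, ht u u.2]
    rfl
  have key := RealizesCyclic.of_isStrictOrder q lt τ
    (fun x y => by simp only [lt]; rw [← htR x x.2 y y.2]; rfl) ?_ ?_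
  · rwa [Fintype.card_fin] at key
  · intro c
    refine ⟨fun h => ?_, fun ⟨d, hd⟩ => by rw [hd, pow_mul, hτq, one_pow]⟩
    rw [← Nat.mod_add_div c q, pow_add, pow_mul, hτq, one_pow, mul_one] at h
    refine Nat.dvd_of_mod_eq_zero (htq _ (Nat.mod_lt _ hq0) fun u hu => ?_)
    rw [← hτ _ ⟨u, hu⟩, h]
    rfl
  · intro σ hσ
    let f : ℕ → ℕ := fun u => if h : u < N then σ ⟨u, h⟩ else 0
    have hf : ∀ (u) (hu : u < N), f u = σ ⟨u, hu⟩ := fun u hu => by simp [f, hu]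
    have hok := ok_of_searchAut (N := N) (R := R) (f := f)
      (ok := fun l => (List.range q).any fun c => l == revValues t^[c] N)
      (fun u hu v hv => by
        rw [hf u hu, hf v hv, Bool.eq_iff_iff]
        exact hσ ⟨u, hu⟩ ⟨v, hv⟩)
      (fun u hu v hv huv => by
        rw [hf u hu, hf v hv] at huv
        exact Fin.mk.inj (σ.injective (Fin.ext huv)))
      (fun u hu => by rw [hf u hu]; exact Fin.is_lt _) (k := 0) (m := N) (by omega) hs
    simp only [List.any_eq_true, beq_iff_eq] at hok
    obtain ⟨c, -, hc⟩ := hok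
    refine ⟨c, ?_⟩
    ext u
    rw [hτ, ← eq_of_revValues_eq hc u u.2, hf u u.2]

/-- The relation on `{0, …, 3q - 1}` with `3i < 3i + 1 < 3i + 2` and `3i < 3(i + 1) + 2`, where
`i` is taken modulo `q`. -/
def threeLevelRel (q u v : ℕ) : Bool :=
  (u / 3 == v / 3 && Nat.blt u v) || (u % 3 == 0 && v % 3 == 2 && v / 3 == (u / 3 + 1) % q)

/-- The relation on `{0, …, 15}` with `2i < 2(i + s) + 1` for `s = 0, 1, 2, 4`, where `i` is taken
modulo `8`. -/
def eightRel (u v : ℕ) : Bool :=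
  u % 2 == 0 && v % 2 == 1 && [0, 1, 2, 4].contains ((v / 2 + 8 - u / 2) % 8)

/-- The kind in `{0, 1, 2, 3}` of a point of the poset `twelveRel` on `{0, …, 19}`. -/
def twelveKind (u : ℕ) : ℕ := if u < 16 then u % 4 else 3 * (u % 2)

/-- The index of a point of `twelveRel` among those of its kind: it is less than `4` for the kinds
`1`, `2`, and less than `6` for the kinds `0`, `3`. -/
def twelveIndex (u : ℕ) : ℕ := if u < 16 then u / 4 else u / 2 - 4

/-- A relation on `{0, …, 19}`: the kinds `1`, `2` form a crown on two copies of `ℤ/4ℤ`, the kinds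
`0`, `3` a bipartite relation on two copies of `ℤ/6ℤ`, and parities link both parts. -/
def twelveRel (u v : ℕ) : Bool :=
  match twelveKind u, twelveKind v with
  | 2, 1 => [0, 1].contains ((twelveIndex v + 4 - twelveIndex u) % 4)
  | 3, 0 => [0, 1, 3].contains ((twelveIndex v + 6 - twelveIndex u) % 6)
  | 2, 3 => (twelveIndex u + twelveIndex v) % 2 == 0
  | 1, 0 => (twelveIndex u + twelveIndex v) % 2 == 0
  | 2, 0 => true
  | _, _ => false

/-- The automorphism of `twelveRel` that increases all indices. -/
def twelveShift (u : ℕ) : ℕ :=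
  if twelveKind u % 3 = 0 then
    if u < 12 then u + 4 else [16, 0, 0, 17, 18, 19, 0, 3].getD (u - 12) 0
  else (u + 4) % 16

theorem realizesCyclic_two : RealizesCyclic 2 2 := by
  apply RealizesCyclic.of_searchAut (by norm_num) (fun _ _ => false) (fun u => 1 - u) <;>
    decide +kernel

theorem realizesCyclic_three : RealizesCyclic 9 3 := by
  apply RealizesCyclic.of_searchAut (by norm_num) (threeLevelRel 3) (fun u => (u + 3) % 9) <;>
    decide +kernel

theorem realizesCyclic_four : RealizesCyclic 12 4 := by
  apply RealizesCyclic.of_searchAut (by norm_num) (threeLevelRel 4) (fun u => (u + 3) % 12) <;>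
    decide +kernel

theorem realizesCyclic_five : RealizesCyclic 15 5 := by
  apply RealizesCyclic.of_searchAut (by norm_num) (threeLevelRel 5) (fun u => (u + 3) % 15) <;>
    decide +kernel

theorem realizesCyclic_seven : RealizesCyclic 21 7 := by
  apply RealizesCyclic.of_searchAut (by norm_num) (threeLevelRel 7) (fun u => (u + 3) % 21) <;>
    decide +kernel

theorem realizesCyclic_eight : RealizesCyclic 16 8 := by
  apply RealizesCyclic.of_searchAut (by norm_num) eightRel (fun u => (u + 2) % 16) <;>
    decide +kernel

theorem realizesCyclic_twelve : RealizesCyclic 20 12 := by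
  apply RealizesCyclic.of_searchAut (by norm_num) twelveRel twelveShift <;> decide +kernel

/-! ### Two-level posets -/

/-- `0`, `1`, `2`, `4`: the relation `j - i ∈ {0, 1, 2, 4}` on `ℤ/qℤ` has no automorphisms but the
translations, for `q ≥ 9`. -/
def IsStep {R : Type*} [AddGroupWithOne R] (d : R) : Prop := d = 0 ∨ d = 1 ∨ d = 2 ∨ d = 4

theorem IsStep.exists_int {q : ℕ} {d : ZMod q} (h : IsStep d) :
    ∃ a : ℤ, IsStep a ∧ (a : ZMod q) = d := by
  rcases h with rfl | rfl | rfl | rfl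
  · exact ⟨0, by simp [IsStep], by simp⟩
  · exact ⟨1, by simp [IsStep], by simp⟩
  · exact ⟨2, by simp [IsStep], by simp⟩
  · exact ⟨4, by simp [IsStep], by simp⟩

theorem IsStep.intCast {q : ℕ} {a : ℤ} (h : IsStep a) : IsStep (a : ZMod q) := by
  rcases h with rfl | rfl | rfl | rfl <;> simp [IsStep]

theorem eq_zero_of_intCast_eq_zero {q : ℕ} {a : ℤ} (h : (a : ZMod q) = 0) (ha : |a| < q) :
    a = 0 :=
  Int.eq_zero_of_abs_lt_dvd ((ZMod.intCast_zmod_eq_zero_iff_dvd a q).mp h) ha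

theorem IsStep.of_sub_eq_sub {x y u v : ℤ} (hx : IsStep x) (hy : IsStep y) (hu : IsStep u)
    (hv : IsStep v) (hxy : x ≠ y) (hxu : x ≠ u) (h : x - u = y - v) :
    ((x = 4 → y = 2) ∧ (y = 4 → x = 2)) ∧ ((u = 4 → v = 2) ∧ (v = 4 → u = 2)) := by
  unfold IsStep at *
  omega

theorem translation_of_isStep_iff {q : ℕ} (hq : 9 ≤ q) {f g : ZMod q → ZMod q}
    (hf : Function.Injective f) (hg : Function.Injective g)
    (h : ∀ i j, IsStep (j - i) → IsStep (g j - f i)) (i : ZMod q) :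
    f (i + 1) = f i + 1 ∧ g i = f i := by
  have hne : ∀ {a b : ℤ} (x : ZMod q), IsStep a → IsStep b → a ≠ b → x + a ≠ x + b := by
    intro a b x ha hb hab hx
    apply hab
    have h0 : ((a - b : ℤ) : ZMod q) = 0 := by
      push_cast; rw [sub_eq_zero]; exact add_left_cancel hx
    have := eq_zero_of_intCast_eq_zero h0 (by
      rw [abs_lt]; unfold IsStep at ha hb; constructor <;> omega)
    omega
  have hA : ∀ (i : ZMod q) (s : ℤ), ∃ a : ℤ, IsStep s → IsStep a ∧ g (i + s) = f i + a := by
    intro i s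
    by_cases hs : IsStep s
    · obtain ⟨a, ha, ha'⟩ := (h i (i + s) (by simpa using hs.intCast)).exists_int
      exact ⟨a, fun _ => ⟨ha, by rw [ha']; ring⟩⟩
    · exact ⟨0, fun h => absurd h hs⟩
  choose A hA using hA
  have h0 : IsStep (0 : ℤ) := by simp [IsStep]
  have h1 : IsStep (1 : ℤ) := by simp [IsStep]
  have h2 : IsStep (2 : ℤ) := by simp [IsStep]
  have h4 : IsStep (4 : ℤ) := by simp [IsStep]
  have hAne : ∀ i {s s' : ℤ}, IsStep s → IsStep s' → s ≠ s' → A i s ≠ A i s' := by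
    intro i s s' hs hs' hss e
    apply hne i hs hs' hss
    apply hg
    rw [(hA i s hs).2, (hA i s' hs').2, e]
  have rect : ∀ (i : ZMod q) (d s s' u u' : ℤ), IsStep s → IsStep s' → IsStep u → IsStep u' →
      s ≠ s' → u + d = s → u' + d = s' → d ≠ 0 → |d| < q →
      ((A i s = 4 → A i s' = 2) ∧ (A i s' = 4 → A i s = 2)) ∧
      ((A (i + d) u = 4 → A (i + d) u' = 2) ∧ (A (i + d) u' = 4 → A (i + d) u = 2)) := by
    intro i d s s' u u' hs hs' hu hu' hss e e' hd hdq
    have E1 := (hA i s hs).2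
    have E2 := (hA i s' hs').2
    have E3 := (hA (i + d) u hu).2
    have E4 := (hA (i + d) u' hu').2
    rw [show i + (d : ZMod q) + u = i + s by rw [← e]; push_cast; ring, E1] at E3
    rw [show i + (d : ZMod q) + u' = i + s' by rw [← e']; push_cast; ring, E2] at E4
    have a1 := (hA i s hs).1
    have a2 := (hA i s' hs').1
    have a3 := (hA (i + d) u hu).1
    have a4 := (hA (i + d) u' hu').1
    refine IsStep.of_sub_eq_sub a1 a2 a3 a4 (hAne i hs hs' hss) (fun e3 => ?_) ?_
    · rw [e3] at E3
      have e4 := hf (add_right_cancel E3)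
      exact hd (eq_zero_of_intCast_eq_zero (by simpa using e4) hdq)
    · have h0 : ((A i s - A (i + d) u - A i s' + A (i + d) u' : ℤ) : ZMod q) = 0 := by
        push_cast; linear_combination E3 - E4
      have := eq_zero_of_intCast_eq_zero h0 (by
        rw [abs_lt]; unfold IsStep at a1 a2 a3 a4; constructor <;> omega)
      omega
  have hA24 : ∀ i, A i 4 = 4 ∧ A i 2 = 2 := by
    intro i
    have r1 := (rect i 1 1 2 0 1 h1 h2 h0 h1 (by simp) (by simp) (by simp) (by simp)
      (by simp; omega)).1
    have r2 := (rect (i - 1) 1 1 2 0 1 h1 h2 h0 h1 (by simp) (by simp) (by simp) (by simp)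
      (by simp; omega)).2
    have r3 := (rect i 2 2 4 0 2 h2 h4 h0 h2 (by simp) (by simp) (by simp) (by simp)
      (by simp; omega)).1
    have r4 := (rect (i - 2) 2 2 4 0 2 h2 h4 h0 h2 (by simp) (by simp) (by simp) (by simp)
      (by simp; omega)).2
    rw [Int.cast_one, sub_add_cancel] at r2
    rw [Int.cast_ofNat, sub_add_cancel] at r4
    have b0 := (hA i 0 h0).1
    have b1 := (hA i 1 h1).1
    have b2 := (hA i 2 h2).1
    have b4 := (hA i 4 h4).1
    have n01 := hAne i h0 h1 (by simp)
    have n02 := hAne i h0 h2 (by simp)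
    have n04 := hAne i h0 h4 (by simp)
    have n12 := hAne i h1 h2 (by simp)
    have n14 := hAne i h1 h4 (by simp)
    have n24 := hAne i h2 h4 (by simp)
    unfold IsStep at b0 b1 b2 b4
    omega
  have hg2 : ∀ i, g (i + 2) = f i + 2 := fun i => by simpa [hA24 i] using (hA i 2 h2).2
  have hg4 : ∀ i, g (i + 4) = f i + 4 := fun i => by simpa [hA24 i] using (hA i 4 h4).2
  have hf2 : ∀ i, f (i + 2) = f i + 2 := fun i => by
    have e1 := hg2 (i + 2)
    rw [show i + 2 + 2 = i + 4 by ring, hg4] at e1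
    linear_combination -e1
  constructor
  · have e1 := (hA (i + 1) 1 h1).2
    rw [Int.cast_one, show i + 1 + 1 = i + 2 by ring, hg2] at e1
    have b1 := (hA (i + 1) 1 h1).1
    have n12 := hAne (i + 1) h1 h2 (by simp)
    have n14 := hAne (i + 1) h1 h4 (by simp)
    rw [(hA24 (i + 1)).2] at n12
    rw [(hA24 (i + 1)).1] at n14
    rcases b1 with b | b | b | b
    · rw [b, ← hf2, Int.cast_zero, add_zero] at e1
      have e2 := hf e1
      have e3 : ((1 : ℤ) : ZMod q) = 0 := by push_cast; linear_combination e2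
      have := eq_zero_of_intCast_eq_zero e3 (by simp; omega)
      omega
    · rw [b, Int.cast_one] at e1
      linear_combination -e1
    · exact absurd b n12
    · exact absurd b n14
  · have e1 := hg2 (i - 2)
    have e2 := hf2 (i - 2)
    rw [sub_add_cancel] at e1 e2
    rw [e1, e2]

theorem realizesCyclic_of_nine_le {q : ℕ} (hq : 9 ≤ q) : RealizesCyclic (2 * q) q := by
  have : NeZero q := ⟨by omega⟩
  let lt : ZMod q ⊕ ZMod q → ZMod q ⊕ ZMod q → Prop
    | Sum.inl i, Sum.inr j => IsStep (j - i)
    | _, _ => False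
  have : IsStrictOrder (ZMod q ⊕ ZMod q) lt :=
    { irrefl := by rintro (i | i) h <;> exact h
      trans := by
        rintro (i | i) (j | j) (k | k) h1 h2
        all_goals first | exact h1.elim | exact h2.elim }
  let τ : Perm (ZMod q ⊕ ZMod q) := Equiv.sumCongr (Equiv.addRight 1) (Equiv.addRight 1)
  have hτl : ∀ (c : ℕ) (i : ZMod q), (τ ^ c) (Sum.inl i) = Sum.inl (i + c) := by
    intro c
    induction c with
    | zero => intro i; simp
    | succ c ih =>
      intro i
      rw [pow_succ]
      refine (ih (i + 1)).trans ?_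
      push_cast
      ring_nf
  have hτr : ∀ (c : ℕ) (i : ZMod q), (τ ^ c) (Sum.inr i) = Sum.inr (i + c) := by
    intro c
    induction c with
    | zero => intro i; simp
    | succ c ih =>
      intro i
      rw [pow_succ]
      refine (ih (i + 1)).trans ?_
      push_cast
      ring_nf
  have key := RealizesCyclic.of_isStrictOrder q lt τ ?_ ?_ ?_
  · rwa [Fintype.card_sum, ZMod.card, ← two_mul] at key
  · rintro (i | i) (j | j)
    · exact Iff.rfl
    · change IsStep (j + 1 - (i + 1)) ↔ IsStep (j - i)
      rw [add_sub_add_right_eq_sub]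
    · exact Iff.rfl
    · exact Iff.rfl
  · intro c
    rw [← ZMod.natCast_eq_zero_iff]
    refine ⟨fun h => ?_, fun h => ?_⟩
    · have := hτl c 0
      rw [h] at this
      simpa using this.symm
    · ext (i | i)
      · rw [hτl, h, add_zero]; rfl
      · rw [hτr, h, add_zero]; rfl
  · intro σ hσ
    have hl : ∀ i, ∃ i', σ (Sum.inl i) = Sum.inl i' := by
      intro i
      have := (hσ (Sum.inl i) (Sum.inr i)).2 (by simp [lt, IsStep])
      rcases h : σ (Sum.inl i) with i' | i'
      · exact ⟨i', rfl⟩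
      · rw [h] at this
        exact this.elim
    have hr : ∀ i, ∃ i', σ (Sum.inr i) = Sum.inr i' := by
      intro i
      have := (hσ (Sum.inl i) (Sum.inr i)).2 (by simp [lt, IsStep])
      obtain ⟨j, hj⟩ := hl i
      rcases h : σ (Sum.inr i) with i' | i'
      · rw [h, hj] at this
        exact this.elim
      · exact ⟨i', rfl⟩
    choose f hf using hl
    choose g hg using hr
    have hfi : Function.Injective f := fun a b hab =>
      Sum.inl_injective (σ.injective (by rw [hf, hf, hab]))
    have hgi : Function.Injective g := fun a b hab =>
      Sum.inr_injective (σ.injective (by rw [hg, hg, hab]))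
    have htr := translation_of_isStep_iff hq hfi hgi fun i j hij => by
      have := (hσ (Sum.inl i) (Sum.inr j)).2 hij
      rwa [hf, hg] at this
    have hn : ∀ n : ℕ, f n = n + f 0 := by
      intro n
      induction n with
      | zero => simp
      | succ n ih => push_cast; rw [(htr n).1, ih]; ring
    have hz : ∀ i, f i = i + f 0 := fun i => by
      have := hn i.val
      rwa [ZMod.natCast_zmod_val] at this
    refine ⟨(f 0).val, ?_⟩
    ext (i | i)
    · rw [hτl, hf, hz, ZMod.natCast_zmod_val]
    · rw [hτr, hg, (htr i).2, hz, ZMod.natCast_zmod_val]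

/-! ### Prime powers and assembly -/

theorem realizesCyclic_prime_pow {p r : ℕ} (hp : p.Prime) (hr : 1 ≤ r) :
    RealizesCyclic (b (p ^ r) * p ^ r) (p ^ r) := by
  have h2 : 2 ≤ p ^ r := hp.two_le.trans (Nat.le_self_pow (by omega) p)
  have h6 : p ^ r ≠ 6 := by
    intro h
    have h3 : p = 3 := ((Nat.prime_dvd_prime_iff_eq Nat.prime_three hp).1
      (Nat.prime_three.dvd_of_dvd_pow (by rw [h]; norm_num))).symm
    have h2 : p = 2 := ((Nat.prime_dvd_prime_iff_eq Nat.prime_two hp).1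
      (Nat.prime_two.dvd_of_dvd_pow (by rw [h]; norm_num))).symm
    omega
  generalize p ^ r = q at *
  rcases lt_or_ge q 9 with h9 | h9
  · interval_cases q
    · exact realizesCyclic_two
    · exact realizesCyclic_three
    · exact realizesCyclic_four
    · exact realizesCyclic_five
    · exact absurd rfl h6
    · exact realizesCyclic_seven
    · exact realizesCyclic_eight
  · have : b q = 2 := by
      unfold b
      repeat rw [if_neg (by omega)]
    rw [this]
    exact realizesCyclic_of_nine_le h9

theorem exists_pow_eq_of_dvd_of_not_dvd {k : ℕ} {p r : Fin k → ℕ} (hp : ∀ i, (p i).Prime)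
    (hinj : Function.Injective p) {l s : ℕ} (hl : l.Prime) (hs : s ≠ 0)
    (h : l ^ s ∣ ∏ i, p i ^ r i) (h' : ¬ l ^ (s + 1) ∣ ∏ i, p i ^ r i) :
    ∃ i, p i ^ r i = l ^ s := by
  obtain ⟨i, -, hi⟩ := (hl.prime.dvd_finsetProd_iff _).1 ((dvd_pow_self l hs).trans h)
  obtain rfl := (Nat.prime_dvd_prime_iff_eq hl (hp i)).1 (hl.dvd_of_dvd_pow hi)
  refine ⟨i, congrArg _ ?_⟩
  rw [← Finset.mul_prod_erase _ _ (Finset.mem_univ i)] at h h'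
  have hco : (p i ^ s).Coprime (∏ j ∈ Finset.univ.erase i, p j ^ r j) :=
    Nat.Coprime.prod_right fun j hj => Nat.Coprime.pow _ _
      ((Nat.coprime_primes (hp i) (hp j)).2 (hinj.ne (Finset.ne_of_mem_erase hj).symm))
  have h1 : s ≤ r i := (Nat.pow_dvd_pow_iff_le_right (hp i).one_lt).1 (hco.dvd_of_dvd_mul_right h)
  have h2 : ¬ s + 1 ≤ r i := fun h3 => h' ((pow_dvd_pow _ h3).mul_right _)
  omega

/-- Let `n = p₁^{r₁} ⋯ p_k^{r_k}` with distinct primes `p_i` and `r_i ≥ 1`. There exists a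
finite poset with automorphism group isomorphic to `ℤ/nℤ` having
`(Σ b(p_i^{r_i})·p_i^{r_i}) - 1` points if `3 ∥ n` and `4 ∥ n`, and
`Σ b(p_i^{r_i})·p_i^{r_i}` points otherwise. -/
theorem exists_poset_aut_cyclic (n k : ℕ) (p r : Fin k → ℕ)
    (hp : ∀ i, (p i).Prime) (hr : ∀ i, 1 ≤ r i) (hinj : Function.Injective p)
    (hn : n = ∏ i, p i ^ r i) :
    ∃ (P : Type) (instP : PartialOrder P) (instF : Fintype P),
      @Fintype.card P instF =
        (if ExactDvd 3 n ∧ ExactDvd 4 n then (∑ i, b (p i ^ r i) * p i ^ r i) - 1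
         else ∑ i, b (p i ^ r i) * p i ^ r i) ∧
      Nonempty ((@OrderIso P P instP.toLE instP.toLE) ≃* Multiplicative (ZMod n)) := by
  subst hn
  have hreal : ∀ i, RealizesCyclic (b (p i ^ r i) * p i ^ r i) (p i ^ r i) := fun i =>
    realizesCyclic_prime_pow (hp i) (hr i)
  have hco : ∀ i j, i ≠ j → (p i ^ r i).Coprime (p j ^ r j) := fun i j hij =>
    Nat.Coprime.pow _ _ ((Nat.coprime_primes (hp i) (hp j)).2 (hinj.ne hij))
  change RealizesCyclic _ _
  split_ifs with h
  · obtain ⟨⟨h3, h3'⟩, h4, h4'⟩ := h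
    have m3 : Nat.minFac 3 = 3 := by norm_num
    have m4 : Nat.minFac 4 = 2 := by norm_num
    rw [m3] at h3'
    rw [m4] at h4'
    obtain ⟨i, hi⟩ := exists_pow_eq_of_dvd_of_not_dvd (r := r) hp hinj Nat.prime_three one_ne_zero
      h3 h3'
    obtain ⟨j, hj⟩ := exists_pow_eq_of_dvd_of_not_dvd (r := r) hp hinj Nat.prime_two two_ne_zero
      h4 h4'
    have hij : j ≠ i := by rintro rfl; omega
    have hj' : j ∈ Finset.univ.erase i := by simp [hij]
    rw [← Finset.add_sum_erase _ _ (Finset.mem_univ i), ← Finset.add_sum_erase _ _ hj',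
      ← Finset.mul_prod_erase _ _ (Finset.mem_univ i), ← Finset.mul_prod_erase _ _ hj', hi, hj]
    have hb3 : b (3 ^ 1) * 3 ^ 1 = 9 := rfl
    have hb4 : b (2 ^ 2) * 2 ^ 2 = 12 := rfl
    have hrest := RealizesCyclic.sum ((Finset.univ.erase i).erase j)
      (fun i => b (p i ^ r i) * p i ^ r i) (fun i => p i ^ r i) (fun i _ => hreal i)
      (fun i _ j _ hij => hco i j hij)
    have key := realizesCyclic_twelve.add hrest (Nat.Coprime.prod_right fun l hl => by
      simp only [Finset.mem_erase, Finset.mem_univ, and_true] at hl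
      have c3 := hco i l hl.2.symm
      have c4 := hco j l hl.1.symm
      rw [hi] at c3
      rw [hj] at c4
      exact Nat.Coprime.mul_left c3 c4)
    rw [hb3, hb4]
    convert key using 1
    · omega
    · ring
  · exact RealizesCyclic.sum Finset.univ _ _ (fun i _ => hreal i) (fun i _ j _ hij => hco i j hij)
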